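/- (Controller perturbation for the misspecified model.) Suppose σ̲(R) ≥ 1, ‖A_t − Â_t‖ ≤ ε_A and ‖B_t − B̂_t‖ ≤ ε_B for all t = 0,…,H−1, and ‖P*_{t+1} − P^CE_{t+1}‖ ≤ f_{t+1} for some f_{t+1} ≥ 0, where ε_A, ε_B, f_{t+1} are all strictly less than Γ. Then for all t = 0,…,H−1, ‖K*_t − K^CE_t‖ ≤ 14Γ³ε_t, where ε_t = max{ε_A, ε_B, f_{t+1}}. -/

import Mathlib

open Matrix

/-- The operator norm of a real matrix induced by the Euclidean vector norm. -/
noncomputable def mnorm {m n : ℕ} (A : Matrix (Fin m) (Fin n) ℝ) : ℝ :=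
  ‖LinearMap.toContinuousLinearMap (Matrix.toEuclideanLin A)‖

/-- The Euclidean norm of a real vector. -/
noncomputable def vnorm {n : ℕ} (x : Fin n → ℝ) : ℝ :=
  Real.sqrt (∑ i, x i ^ 2)


open scoped Matrix.Norms.L2Operator in
theorem mnorm_eq' {m n : ℕ} (A : Matrix (Fin m) (Fin n) ℝ) : mnorm A = ‖A‖ := rfl

theorem mnorm_nonneg' {m n : ℕ} (A : Matrix (Fin m) (Fin n) ℝ) : 0 ≤ mnorm A := norm_nonneg _

open scoped Matrix.Norms.L2Operator in
theorem mnorm_mul' {m n k : ℕ} (A : Matrix (Fin m) (Fin n) ℝ) (B : Matrix (Fin n) (Fin k) ℝ) :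
    mnorm (A * B) ≤ mnorm A * mnorm B := Matrix.l2_opNorm_mul A B

open scoped Matrix.Norms.L2Operator in
theorem mnorm_add' {m n : ℕ} (A B : Matrix (Fin m) (Fin n) ℝ) :
    mnorm (A + B) ≤ mnorm A + mnorm B := norm_add_le A B

open scoped Matrix.Norms.L2Operator in
theorem mnorm_sub_comm' {m n : ℕ} (A B : Matrix (Fin m) (Fin n) ℝ) :
    mnorm (A - B) = mnorm (B - A) := norm_sub_rev A B

open scoped Matrix.Norms.L2Operator in
theorem mnorm_transpose' {m n : ℕ} (A : Matrix (Fin m) (Fin n) ℝ) :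
    mnorm Aᵀ = mnorm A := by
  have := Matrix.l2_opNorm_conjTranspose A
  rwa [conjTranspose_eq_transpose_of_trivial] at this

theorem vnorm_eq' {n : ℕ} (x : Fin n → ℝ) : vnorm x = ‖WithLp.toLp 2 x‖ := by
  simp [vnorm, EuclideanSpace.norm_eq]

theorem vnorm_sq' {n : ℕ} (x : Fin n → ℝ) : vnorm x ^ 2 = x ⬝ᵥ x := by
  rw [vnorm, Real.sq_sqrt (Finset.sum_nonneg fun i _ => sq_nonneg _)]
  simp [dotProduct, sq]

theorem vnorm_mulVec' {m n : ℕ} (A : Matrix (Fin m) (Fin n) ℝ) (x : Fin n → ℝ) :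
    vnorm (A *ᵥ x) ≤ mnorm A * vnorm x := by
  rw [vnorm_eq', vnorm_eq']
  exact (LinearMap.toContinuousLinearMap (Matrix.toEuclideanLin A)).le_opNorm (WithLp.toLp 2 x)

theorem mnorm_le' {m n : ℕ} (A : Matrix (Fin m) (Fin n) ℝ) (c : ℝ) (hc : 0 ≤ c)
    (h : ∀ x, vnorm (A *ᵥ x) ≤ c * vnorm x) : mnorm A ≤ c := by
  refine ContinuousLinearMap.opNorm_le_bound _ hc fun x => ?_
  have := h x.ofLp
  rw [vnorm_eq', vnorm_eq'] at this
  exact this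

theorem dot_le' {n : ℕ} (x y : Fin n → ℝ) : x ⬝ᵥ y ≤ vnorm x * vnorm y := by
  have := real_inner_le_norm (WithLp.toLp 2 y : EuclideanSpace ℝ (Fin n)) (WithLp.toLp 2 x)
  rw [EuclideanSpace.inner_eq_star_dotProduct] at this
  rw [vnorm_eq', vnorm_eq', mul_comm]
  simpa using this

theorem R_sub_one {d : ℕ} (R : Matrix (Fin d) (Fin d) ℝ) (hR : R.PosDef)
    (hσR : ∀ v : Fin d → ℝ, vnorm v ≤ vnorm (R.mulVec v)) : (R - 1).PosSemidef := by
  have hH : (R - 1).IsHermitian := hR.isHermitian.sub isHermitian_one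
  rw [hH.posSemidef_iff_eigenvalues_nonneg]
  intro i
  set v : Fin d → ℝ := (hH.eigenvectorBasis i).ofLp with hv
  have h1 : (R - 1) *ᵥ v = hH.eigenvalues i • v := hH.mulVec_eigenvectorBasis i
  set μ := hH.eigenvalues i
  have hn : vnorm v = 1 := by
    rw [vnorm_eq']; exact hH.eigenvectorBasis.orthonormal.1 i
  have hvv : v ⬝ᵥ v = 1 := by rw [← vnorm_sq', hn]; norm_num
  have hv0 : v ≠ 0 := by
    intro h; rw [h] at hvv; simp at hvv
  have h2 : R *ᵥ v = (1 + μ) • v := by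
    rw [sub_mulVec, one_mulVec, sub_eq_iff_eq_add] at h1
    rw [h1, add_smul, one_smul, add_comm]
  have h3 := hR.dotProduct_mulVec_pos hv0
  rw [h2] at h3
  simp only [star_trivial, dotProduct_smul, hvv, smul_eq_mul, mul_one] at h3
  have h4 := hσR v
  rw [hn] at h4
  have h5 : vnorm (R *ᵥ v) ^ 2 = (1 + μ) ^ 2 := by
    rw [vnorm_sq', h2]; simp [hvv, sq]
  show 0 ≤ μ
  nlinarith

theorem coercive' {d : ℕ} (M : Matrix (Fin d) (Fin d) ℝ) (hM : (M - 1).PosSemidef)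
    (v : Fin d → ℝ) : vnorm v ≤ vnorm (M *ᵥ v) := by
  have h := hM.dotProduct_mulVec_nonneg v
  rw [sub_mulVec, one_mulVec, dotProduct_sub] at h
  simp only [star_trivial] at h
  have h1 := dot_le' v (M *ᵥ v)
  have h2 := vnorm_sq' v
  have h3 : 0 ≤ vnorm v := Real.sqrt_nonneg _
  have h4 : 0 ≤ vnorm (M *ᵥ v) := Real.sqrt_nonneg _
  rcases h3.eq_or_lt with h5 | h5
  · rw [← h5]; exact h4
  · refine le_of_mul_le_mul_left ?_ h5
    nlinarith

theorem ric_step {n d : ℕ} (A P Q : Matrix (Fin n) (Fin n) ℝ) (B : Matrix (Fin n) (Fin d) ℝ)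
    (R : Matrix (Fin d) (Fin d) ℝ) (hR : R.PosDef) (hQ : Q.PosDef) (hP : P.PosDef) :
    (Q + Aᵀ * P * (1 + B * R⁻¹ * Bᵀ * P)⁻¹ * A).PosDef := by
  have hS : (B * R⁻¹ * Bᵀ).PosSemidef := by
    have := hR.inv.posSemidef.mul_mul_conjTranspose_same B
    rwa [conjTranspose_eq_transpose_of_trivial] at this
  have hu : IsUnit P.det := (Matrix.isUnit_iff_isUnit_det _).1 hP.isUnit
  have h1 : P * (1 + B * R⁻¹ * Bᵀ * P)⁻¹ = (P⁻¹ + B * R⁻¹ * Bᵀ)⁻¹ := by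
    have : P⁻¹ + B * R⁻¹ * Bᵀ = (1 + B * R⁻¹ * Bᵀ * P) * P⁻¹ := by
      rw [add_mul, one_mul, Matrix.mul_nonsing_inv_cancel_right _ _ hu]
    rw [this, Matrix.mul_inv_rev, Matrix.nonsing_inv_nonsing_inv _ hu]
  refine hQ.add_posSemidef ?_
  rw [Matrix.mul_assoc Aᵀ, h1]
  have := (hP.inv.add_posSemidef hS).inv.posSemidef.conjTranspose_mul_mul_same A
  rwa [conjTranspose_eq_transpose_of_trivial] at this

theorem ric_posDef {n d H : ℕ} (A : ℕ → Matrix (Fin n) (Fin n) ℝ)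
    (B : ℕ → Matrix (Fin n) (Fin d) ℝ) (Q Qf : Matrix (Fin n) (Fin n) ℝ)
    (R : Matrix (Fin d) (Fin d) ℝ) (hQ : Q.PosDef) (hQf : Qf.PosDef) (hR : R.PosDef)
    (P : ℕ → Matrix (Fin n) (Fin n) ℝ) (hPH : P H = Qf)
    (hP : ∀ t, t < H → P t =
      Q + (A t)ᵀ * P (t+1) * (1 + B t * R⁻¹ * (B t)ᵀ * P (t+1))⁻¹ * A t)
    (t : ℕ) (ht : t ≤ H) : (P t).PosDef := by
  induction ht using Nat.decreasingInduction with
  | self => rw [hPH]; exact hQf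
  | of_succ k hk ih => rw [hP k hk]; exact ric_step _ _ _ _ _ hR hQ ih

theorem triple {n d k : ℕ} (B B' : Matrix (Fin n) (Fin d) ℝ) (P P' : Matrix (Fin n) (Fin n) ℝ)
    (C C' : Matrix (Fin n) (Fin k) ℝ) (Γ ε : ℝ) (he : ε ≤ Γ)
    (hB : mnorm B ≤ Γ) (hP : mnorm P ≤ Γ) (hC : mnorm C ≤ Γ)
    (hB' : mnorm (B - B') ≤ ε) (hP' : mnorm (P - P') ≤ ε) (hC' : mnorm (C - C') ≤ ε) :
    mnorm (B'ᵀ * P' * C' - Bᵀ * P * C) ≤ 7 * Γ ^ 2 * ε := by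
  have e : B'ᵀ * P' * C' - Bᵀ * P * C =
      (B' - B)ᵀ * P' * C' + Bᵀ * (P' - P) * C' + Bᵀ * P * (C' - C) := by
    simp only [transpose_sub, Matrix.sub_mul, Matrix.mul_sub]; abel
  rw [mnorm_sub_comm'] at hB' hP' hC'
  have p2 : mnorm P' ≤ 2 * Γ := by
    have := mnorm_add' (P' - P) P
    rw [sub_add_cancel] at this; linarith
  have c2 : mnorm C' ≤ 2 * Γ := by
    have := mnorm_add' (C' - C) C
    rw [sub_add_cancel] at this; linarith
  have hΓ0 : 0 ≤ Γ := (mnorm_nonneg' _).trans hB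
  have hε0 : 0 ≤ ε := (mnorm_nonneg' _).trans hB'
  have key : ∀ (X : Matrix (Fin n) (Fin d) ℝ) (Y : Matrix (Fin n) (Fin n) ℝ)
      (Z : Matrix (Fin n) (Fin k) ℝ) (x y z : ℝ), mnorm X ≤ x → mnorm Y ≤ y → mnorm Z ≤ z →
      mnorm (Xᵀ * Y * Z) ≤ x * y * z := by
    intro X Y Z x y z hx hy hz
    have x0 := (mnorm_nonneg' _).trans hx
    have y0 := (mnorm_nonneg' _).trans hy
    calc mnorm (Xᵀ * Y * Z) ≤ mnorm (Xᵀ * Y) * mnorm Z := mnorm_mul' _ _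
      _ ≤ (mnorm Xᵀ * mnorm Y) * mnorm Z :=
        mul_le_mul_of_nonneg_right (mnorm_mul' _ _) (mnorm_nonneg' _)
      _ ≤ x * y * z := by
        rw [mnorm_transpose']
        exact mul_le_mul (mul_le_mul hx hy (mnorm_nonneg' _) x0) hz (mnorm_nonneg' _)
          (mul_nonneg x0 y0)
  have k1 := key _ _ _ _ _ _ hB' p2 c2
  have k2 := key _ _ _ _ _ _ hB hP' c2
  have k3 := key _ _ _ _ _ _ hB hP hC'
  rw [e]
  have a1 := mnorm_add' ((B' - B)ᵀ * P' * C' + Bᵀ * (P' - P) * C') (Bᵀ * P * (C' - C))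
  have a2 := mnorm_add' ((B' - B)ᵀ * P' * C') (Bᵀ * (P' - P) * C')
  nlinarith

theorem M_sub_one {n d : ℕ} (B : Matrix (Fin n) (Fin d) ℝ) (P : Matrix (Fin n) (Fin n) ℝ)
    (R : Matrix (Fin d) (Fin d) ℝ) (hR : (R - 1).PosSemidef) (hP : P.PosDef) :
    (R + Bᵀ * P * B - 1).PosSemidef := by
  have := hP.posSemidef.conjTranspose_mul_mul_same B
  rw [conjTranspose_eq_transpose_of_trivial] at this
  rw [add_sub_right_comm]
  exact hR.add this

theorem M_mul {n d : ℕ} (B : Matrix (Fin n) (Fin d) ℝ) (P : Matrix (Fin n) (Fin n) ℝ)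
    (R : Matrix (Fin d) (Fin d) ℝ) (hR : R.PosDef) (hP : P.PosDef)
    (N K : Matrix (Fin d) (Fin n) ℝ) (hK : K = -((R + Bᵀ * P * B)⁻¹ * N)) :
    (R + Bᵀ * P * B) * K = - N := by
  have := hP.posSemidef.conjTranspose_mul_mul_same B
  rw [conjTranspose_eq_transpose_of_trivial] at this
  rw [hK, Matrix.mul_neg, Matrix.mul_nonsing_inv_cancel_left]
  exact (Matrix.isUnit_iff_isUnit_det _).1 (hR.add_posSemidef this).isUnit

/-- Lemma 2 of the paper: controller perturbation for the misspecified
model. If `σ̲(R) ≥ 1`, the model errors are at most `ε_A, ε_B`, and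
`‖P*_{t+1} - P^CE_{t+1}‖ ≤ f_{t+1}` with `ε_A, ε_B, f_{t+1} < Γ` nonnegative, then
`‖K*_t - K^CE_t‖ ≤ 14 Γ³ ε_t` with `ε_t = max{ε_A, ε_B, f_{t+1}}`. -/
theorem statement10
    (n d H : ℕ)
    (A Ahat : ℕ → Matrix (Fin n) (Fin n) ℝ) (B Bhat : ℕ → Matrix (Fin n) (Fin d) ℝ)
    (Q Qf : Matrix (Fin n) (Fin n) ℝ) (R : Matrix (Fin d) (Fin d) ℝ)
    (hQ : Q.PosDef) (hQf : Qf.PosDef) (hR : R.PosDef)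
    -- `σ̲(R) ≥ 1`
    (hσR : ∀ v : Fin d → ℝ, vnorm v ≤ vnorm (R.mulVec v))
    (Pstar PCE : ℕ → Matrix (Fin n) (Fin n) ℝ)
    (Kstar KCE : ℕ → Matrix (Fin d) (Fin n) ℝ)
    -- optimal Riccati recursion
    (hPH : Pstar H = Qf)
    (hP : ∀ t, t < H → Pstar t =
      Q + (A t)ᵀ * Pstar (t+1) * (1 + B t * R⁻¹ * (B t)ᵀ * Pstar (t+1))⁻¹ * A t)
    (hK : ∀ t, t < H → Kstar t =
      -((R + (B t)ᵀ * Pstar (t+1) * B t)⁻¹ * ((B t)ᵀ * Pstar (t+1) * A t)))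
    -- misspecified-model Riccati recursion
    (hPCEH : PCE H = Qf)
    (hPCE : ∀ t, t < H → PCE t =
      Q + (Ahat t)ᵀ * PCE (t+1) *
        (1 + Bhat t * R⁻¹ * (Bhat t)ᵀ * PCE (t+1))⁻¹ * Ahat t)
    (hKCE : ∀ t, t < H → KCE t =
      -((R + (Bhat t)ᵀ * PCE (t+1) * Bhat t)⁻¹ * ((Bhat t)ᵀ * PCE (t+1) * Ahat t)))
    -- `Γ = 1 + max_t {‖A_t‖, ‖B_t‖, ‖P*_t‖, ‖K*_t‖}` (as an upper bound)
    (Γ : ℝ)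
    (hΓA : ∀ t, t < H → 1 + mnorm (A t) ≤ Γ)
    (hΓB : ∀ t, t < H → 1 + mnorm (B t) ≤ Γ)
    (hΓP : ∀ t, t ≤ H → 1 + mnorm (Pstar t) ≤ Γ)
    (hΓK : ∀ t, t < H → 1 + mnorm (Kstar t) ≤ Γ)
    -- modeling errors
    (εA εB : ℝ)
    (hεA : ∀ t, t < H → mnorm (A t - Ahat t) ≤ εA)
    (hεB : ∀ t, t < H → mnorm (B t - Bhat t) ≤ εB)
    (hεA0 : 0 ≤ εA) (hεB0 : 0 ≤ εB) (hεAΓ : εA < Γ) (hεBΓ : εB < Γ)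
    -- bound on the value-matrix perturbation
    (f : ℕ → ℝ)
    (hf : ∀ t, t < H → mnorm (Pstar (t+1) - PCE (t+1)) ≤ f (t+1))
    (hf0 : ∀ t, t < H → 0 ≤ f (t+1))
    (hfΓ : ∀ t, t < H → f (t+1) < Γ) :
    ∀ t, t < H →
      mnorm (Kstar t - KCE t) ≤ 14 * Γ ^ 3 * max (max εA εB) (f (t+1)) := by

  intro t ht
  have pP := ric_posDef A B Q Qf R hQ hQf hR Pstar hPH hP (t+1) ht
  have pC := ric_posDef Ahat Bhat Q Qf R hQ hQf hR PCE hPCEH hPCE (t+1) ht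
  have e1 := M_mul _ _ R hR pP _ _ (hK t ht)
  have e2 := M_mul _ _ R hR pC _ _ (hKCE t ht)
  set ε := max (max εA εB) (f (t+1)) with hε
  have ea : εA ≤ ε := (le_max_left _ _).trans (le_max_left _ _)
  have eb : εB ≤ ε := (le_max_right _ _).trans (le_max_left _ _)
  have ef : f (t+1) ≤ ε := le_max_right _ _
  have eΓ : ε ≤ Γ := max_le (max_le hεAΓ.le hεBΓ.le) (hfΓ t ht).le
  have hA := (hεA t ht).trans ea
  have hB := (hεB t ht).trans eb
  have hF := (hf t ht).trans ef
  have gA := hΓA t ht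
  have gB := hΓB t ht
  have gP := hΓP (t+1) ht
  have gK := hΓK t ht
  have t1 := triple (B t) (Bhat t) (Pstar (t+1)) (PCE (t+1)) (A t) (Ahat t) Γ ε eΓ
    (by linarith) (by linarith) (by linarith) hB hF hA
  have t2 := triple (B t) (Bhat t) (Pstar (t+1)) (PCE (t+1)) (B t) (Bhat t) Γ ε eΓ
    (by linarith) (by linarith) (by linarith) hB hF hB
  set M := R + (B t)ᵀ * Pstar (t+1) * B t with hM
  set M' := R + (Bhat t)ᵀ * PCE (t+1) * Bhat t with hM'
  have hco := coercive' M' (M_sub_one _ _ R (R_sub_one R hR hσR) pC)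
  have hMM : M' - M = (Bhat t)ᵀ * PCE (t+1) * Bhat t - (B t)ᵀ * Pstar (t+1) * B t := by
    rw [hM, hM']; abel
  rw [← hMM] at t2
  have eq : M' * (Kstar t - KCE t) = (M' - M) * Kstar t +
      ((Bhat t)ᵀ * PCE (t+1) * Ahat t - (B t)ᵀ * Pstar (t+1) * A t) := by
    rw [Matrix.mul_sub, Matrix.sub_mul, e1, e2]; abel
  have h1 : mnorm (Kstar t - KCE t) ≤ mnorm (M' * (Kstar t - KCE t)) := by
    refine mnorm_le' _ _ (mnorm_nonneg' _) fun x => ?_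
    refine (hco _).trans ?_
    rw [Matrix.mulVec_mulVec]
    exact vnorm_mulVec' _ _
  have h2 : mnorm (M' * (Kstar t - KCE t)) ≤ 7 * Γ ^ 2 * ε * (Γ - 1) + 7 * Γ ^ 2 * ε := by
    rw [eq]
    refine (mnorm_add' _ _).trans (add_le_add ((mnorm_mul' _ _).trans ?_) t1)
    exact mul_le_mul t2 (by linarith) (mnorm_nonneg' _) ((mnorm_nonneg' _).trans t2)
  have hε0 : 0 ≤ ε := hεA0.trans ea
  have hΓ0 : 0 ≤ Γ := hε0.trans eΓ
  have h3 : 0 ≤ Γ ^ 3 * ε := by positivity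
  refine h1.trans (h2.trans ?_)
  nlinarith
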